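/- Let G be a primitive graph. There exist N ∈ ℕ and C_0 > 0, depending only on G, such that for every graph H, every payoff function P : E_G × E_H → ℤ, every n > N, and every p ∈ W_n(H), the function M(p) is ℤ-valued and ΔM(p) ≤ C_0·‖P‖. -/

import Mathlib

open Filter Set

structure DirGraph (V E : Type) where
  src : E → V
  tgt : E → V

namespace DirGraph

variable {V E : Type}

/-- A (finite) walk: consecutive edges are compatible. -/
def IsWalkList (G : DirGraph V E) (p : List E) : Prop :=
  p.Chain' fun e f => G.tgt e = G.src f

/-- The set of walks of length `n`. -/
def walks (G : DirGraph V E) (n : ℕ) : Set (List E) :=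
  {p | p.length = n ∧ G.IsWalkList p}

/-- The set of walks of length `n` from `v` to `w`. -/
def walksFT (G : DirGraph V E) (n : ℕ) (v w : V) : Set (List E) :=
  {p | p.length = n ∧ G.IsWalkList p ∧
    ∃ h : p ≠ [], G.src (p.head h) = v ∧ G.tgt (p.getLast h) = w}

def IsCycle (G : DirGraph V E) (p : List E) : Prop :=
  G.IsWalkList p ∧ ∃ h : p ≠ [], G.src (p.head h) = G.tgt (p.getLast h)

def Irreducible (G : DirGraph V E) : Prop :=
  ∀ v w : V, ∃ n : ℕ, (G.walksFT n v w).Nonempty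

/-- Irreducible and the gcd of all cycle lengths is 1 (every common divisor of
the cycle lengths equals 1). -/
def Primitive (G : DirGraph V E) : Prop :=
  G.Irreducible ∧ ∀ d : ℕ, (∀ p, G.IsCycle p → d ∣ p.length) → d = 1

end DirGraph

/-- `Σ_i P(q_i, p_i)`. -/
def payoffSum {EG EH : Type} (P : EG → EH → ℤ) (q : List EG) (p : List EH) : ℤ :=
  (List.zipWith P q p).sum

/-- `V_n(G,H,P) = max_{p ∈ W_n(H)} min_{q ∈ W_n(G)} Σ P(q_i,p_i)`. -/
noncomputable def Vn {VG EG VH EH : Type} (G : DirGraph VG EG) (H : DirGraph VH EH)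
    (P : EG → EH → ℤ) (n : ℕ) : ℤ :=
  sSup ((fun p => sInf ((fun q => payoffSum P q p) '' G.walks n)) '' H.walks n)

/-- `M(p)(v,w) = inf {Σ P(q_i,p_i) : q ∈ W_n(G, v → w)}`, with `inf ∅ = ⊤`. -/
noncomputable def Mfun {VG EG EH : Type} (G : DirGraph VG EG) (P : EG → EH → ℤ)
    (p : List EH) : VG → VG → WithTop ℤ :=
  fun v w => sInf ((fun q => ((payoffSum P q p : ℤ) : WithTop ℤ)) '' G.walksFT p.length v w)

/-- `f < g` pointwise everywhere. -/
def StrictDom {V α : Type} [LT α] (f g : V → V → α) : Prop := ∀ v w, f v w < g v w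

/-- `<`-maximal elements of a set w.r.t. a strict domination relation. -/
def maxElems {α : Type} (lt : α → α → Prop) (A : Set α) : Set α :=
  {f ∈ A | ¬ ∃ g ∈ A, lt f g}

/-- Tropical convolution on `(ℤ ∪ {∞})`-valued matrices. -/
noncomputable def tconv {V : Type} (f g : V → V → WithTop ℤ) : V → V → WithTop ℤ :=
  fun u w => sInf (Set.range fun v => f u v + g v w)

/-- Tropical convolution on `ℤ`-valued matrices. -/
noncomputable def tconvZ {V : Type} (f g : V → V → ℤ) : V → V → ℤ :=
  fun u w => sInf (Set.range fun v => f u v + g v w)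

/-- Non-improvable walks in `H` (of any length). -/
noncomputable def walksDagger {VG EG VH EH : Type} (G : DirGraph VG EG) (H : DirGraph VH EH)
    (P : EG → EH → ℤ) : Set (List EH) :=
  {p | ∃ u v : VH, p ∈ H.walksFT p.length u v ∧
    Mfun G P p ∈ maxElems StrictDom (Mfun G P '' H.walksFT p.length u v)}

/-- The edge shift of a graph. -/
def XEdge {V E : Type} (G : DirGraph V E) : Set (ℤ → E) :=
  {x | ∀ n : ℤ, G.tgt (x n) = G.src (x (n + 1))}

/-- The word `x_{[m,n]}` as a list (of length `n - m + 1` when `m ≤ n`). -/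
def seg {A : Type} (x : ℤ → A) (m n : ℤ) : List A :=
  List.ofFn fun i : Fin (n + 1 - m).toNat => x (m + i)

/-- `X_H^†`: points all of whose subwords are non-improvable walks. -/
noncomputable def XHdag {VG EG VH EH : Type} (G : DirGraph VG EG) (H : DirGraph VH EH)
    (P : EG → EH → ℤ) : Set (ℤ → EH) :=
  {x | x ∈ XEdge H ∧ ∀ m n : ℤ, m ≤ n → seg x m n ∈ walksDagger G H P}

/-- `R(p)`: optimal responses to `p`. -/
noncomputable def Rset {VG EG EH : Type} (G : DirGraph VG EG) (P : EG → EH → ℤ)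
    (p : List EH) : Set (List EG) :=
  {q | ∃ v w : VG, q ∈ G.walksFT p.length v w ∧
    ((payoffSum P q p : ℤ) : WithTop ℤ) = Mfun G P p v w}

namespace DirGraph

variable {V E : Type} {G : DirGraph V E}

theorem append_mem_walksFT {m n : ℕ} {u v w : V} {p q : List E}
    (hp : p ∈ G.walksFT m u v) (hq : q ∈ G.walksFT n v w) :
    p ++ q ∈ G.walksFT (m + n) u w := by
  obtain ⟨hpl, hpw, hp0, hps, hpt⟩ := hp
  obtain ⟨hql, hqw, hq0, hqs, hqt⟩ := hq
  refine ⟨by simp [hpl, hql], ?_, by simp [hp0], ?_, ?_⟩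
  · refine List.isChain_append.2 ⟨hpw, hqw, ?_⟩
    intro x hx y hy
    rw [List.getLast?_eq_some_getLast hp0, Option.mem_some_iff] at hx
    rw [List.head?_eq_some_head hq0, Option.mem_some_iff] at hy
    rw [← hx, ← hy, hpt, hqs]
  · rw [List.head_append_of_ne_nil hp0, hps]
  · rw [List.getLast_append_of_ne_nil _ hq0, hqt]

theorem Primitive.eventually_nonempty_walksFT_self (hG : G.Primitive) (v : V) :
    ∃ T : ℕ, ∀ n ≥ T, (G.walksFT n v v).Nonempty := by
  set S : Set ℕ := {n | (G.walksFT n v v).Nonempty}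
  have hgcd : Nat.setGcd S = 1 := by
    refine hG.2 _ fun p ⟨hpw, hp0, hpc⟩ => ?_
    obtain ⟨a, x, hx⟩ := hG.1 v (G.src (p.head hp0))
    obtain ⟨b, y, hy⟩ := hG.1 (G.src (p.head hp0)) v
    have hp : p ∈ G.walksFT p.length (G.src (p.head hp0)) (G.src (p.head hp0)) :=
      ⟨rfl, hpw, hp0, rfl, hpc.symm⟩
    have h₁ : a + b ∈ S := ⟨_, append_mem_walksFT hx hy⟩
    have h₂ : a + b + p.length ∈ S := by
      rw [show a + b + p.length = a + (p.length + b) by omega]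
      exact ⟨_, append_mem_walksFT hx (append_mem_walksFT hp hy)⟩
    exact (Nat.dvd_add_right (Nat.setGcd_dvd_of_mem h₁)).1 (Nat.setGcd_dvd_of_mem h₂)
  have hclosure : ∀ n ∈ AddSubmonoid.closure S, n = 0 ∨ n ∈ S := by
    intro n hn
    induction hn using AddSubmonoid.closure_induction with
    | mem n hn => exact Or.inr hn
    | zero => exact Or.inl rfl
    | add m n _ _ hm hn =>
      rcases hm with rfl | ⟨x, hx⟩
      · simpa using hn
      rcases hn with rfl | ⟨y, hy⟩
      · exact Or.inr ⟨x, hx⟩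
      · exact Or.inr ⟨_, append_mem_walksFT hx hy⟩
  obtain ⟨T, hT⟩ := Nat.exists_mem_closure_of_ge S
  refine ⟨T + 1, fun n hn => ?_⟩
  exact (hclosure n (hT n (by omega) (hgcd ▸ one_dvd n))).resolve_left (by omega)

theorem Primitive.eventually_nonempty_walksFT [Fintype V] (hG : G.Primitive) :
    ∃ K : ℕ, ∀ n ≥ K, ∀ v w : V, (G.walksFT n v w).Nonempty := by
  choose T hT using fun v => hG.eventually_nonempty_walksFT_self v
  choose l hl using hG.1
  obtain ⟨K, hK⟩ := (Set.finite_range fun vw : V × V => T vw.1 + l vw.1 vw.2).bddAbove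
  refine ⟨K, fun n hn v w => ?_⟩
  have hle : T v + l v w ≤ K := hK ⟨(v, w), rfl⟩
  obtain ⟨x, hx⟩ := hT v (n - l v w) (by omega)
  obtain ⟨y, hy⟩ := hl v w
  have := append_mem_walksFT hx hy
  rw [Nat.sub_add_cancel (by omega)] at this
  exact ⟨_, this⟩

theorem Primitive.nonempty (hG : G.Primitive) : Nonempty V := by
  by_contra h
  rw [not_nonempty_iff] at h
  exact zero_ne_one (hG.2 0 fun p ⟨_, hp, _⟩ => h.elim (G.src (p.head hp)))

theorem finite_walksFT [Finite E] (n : ℕ) (v w : V) : (G.walksFT n v w).Finite :=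
  (List.finite_length_eq E n).subset fun _ hp => hp.1

/-- If any two vertices are joined by a walk of length `K`, the first and last `K` edges of a
walk longer than `2 * K` can be replaced so as to prescribe both endpoints. -/
theorem exists_walksFT_replace_ends {K n : ℕ} (hK : ∀ v w : V, (G.walksFT K v w).Nonempty)
    (hn : 2 * K < n) {q : List E} (hq : q.length = n) (hw : G.IsWalkList q) (v w : V) :
    ∃ a q₁ q₂ q₃ b : List E, q = q₁ ++ (q₂ ++ q₃) ∧ q₁.length = K ∧ q₃.length = K ∧
      a.length = K ∧ b.length = K ∧ a ++ (q₂ ++ b) ∈ G.walksFT n v w := by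
  set r := (q.drop K).take (n - 2 * K) with hr
  set t := (q.drop K).drop (n - 2 * K) with ht
  have hsplit : q = q.take K ++ (r ++ t) := by simp [hr, ht]
  have hrl : r.length = n - 2 * K := by simp [hr, hq]; omega
  have hr0 : r ≠ [] := by
    intro h
    rw [h, List.length_nil] at hrl
    omega
  have hrw : G.IsWalkList r := hw.infix ⟨q.take K, t, by rw [List.append_assoc, ← hsplit]⟩
  obtain ⟨a, ha⟩ := hK v (G.src (r.head hr0))
  obtain ⟨b, hb⟩ := hK (G.tgt (r.getLast hr0)) w
  refine ⟨a, q.take K, r, t, b, hsplit, by simp [hq]; omega, by simp [ht, hq]; omega,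
    ha.1, hb.1, ?_⟩
  have := append_mem_walksFT ha
    (append_mem_walksFT (⟨hrl, hrw, hr0, rfl, rfl⟩ : r ∈ G.walksFT _ _ _) hb)
  rwa [show K + (n - 2 * K + K) = n by omega] at this

end DirGraph

section Payoff

variable {EG EH : Type} (P : EG → EH → ℤ)

theorem payoffSum_append {q₁ q₂ : List EG} {p₁ p₂ : List EH} (h : q₁.length = p₁.length) :
    payoffSum P (q₁ ++ q₂) (p₁ ++ p₂) = payoffSum P q₁ p₁ + payoffSum P q₂ p₂ := by
  simp [payoffSum, List.zipWith_append h]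

theorem abs_payoffSum_le {B : ℤ} (hB : ∀ e f, |P e f| ≤ B) {q : List EG} {p : List EH}
    (h : q.length = p.length) : |payoffSum P q p| ≤ q.length * B := by
  induction q generalizing p with
  | nil => simp [payoffSum]
  | cons e q ih =>
    obtain _ | ⟨f, p⟩ := p
    · simp at h
    · have h₁ : payoffSum P (e :: q) (f :: p) = P e f + payoffSum P q p := by simp [payoffSum]
      have h₂ := ih (p := p) (by simpa using h)
      have h₃ := abs_add_le (P e f) (payoffSum P q p)
      rw [h₁]
      push_cast [List.length_cons]
      linarith [hB e f]

theorem payoffSum_le_of_replace_ends {B : ℤ} (hB : ∀ e f, |P e f| ≤ B) {K : ℕ}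
    {a q₁ q₂ q₃ b : List EG} {p : List EH} (hp : p.length = (q₁ ++ (q₂ ++ q₃)).length)
    (h₁ : q₁.length = K) (h₃ : q₃.length = K) (ha : a.length = K) (hb : b.length = K) :
    payoffSum P (a ++ (q₂ ++ b)) p ≤ payoffSum P (q₁ ++ (q₂ ++ q₃)) p + 4 * K * B := by
  simp only [List.length_append, h₁, h₃] at hp
  have hsplit : p = p.take K ++ ((p.drop K).take q₂.length ++ (p.drop K).drop q₂.length) := by
    simp
  set p₁ := p.take K with hp₁
  set p₂ := (p.drop K).take q₂.length with hp₂
  set p₃ := (p.drop K).drop q₂.length with hp₃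
  have l₁ : p₁.length = K := by simp [hp₁]; omega
  have l₂ : p₂.length = q₂.length := by simp [hp₂]; omega
  have l₃ : p₃.length = K := by simp [hp₃]; omega
  rw [hsplit, payoffSum_append P (ha.trans l₁.symm), payoffSum_append P (h₁.trans l₁.symm),
    payoffSum_append P l₂.symm, payoffSum_append P l₂.symm]
  have ba := abs_le.1 (abs_payoffSum_le P hB (ha.trans l₁.symm))
  have bb := abs_le.1 (abs_payoffSum_le P hB (hb.trans l₃.symm))
  have b₁ := abs_le.1 (abs_payoffSum_le P hB (h₁.trans l₁.symm))
  have b₃ := abs_le.1 (abs_payoffSum_le P hB (h₃.trans l₃.symm))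
  rw [ha] at ba
  rw [hb] at bb
  rw [h₁] at b₁
  rw [h₃] at b₃
  linarith [ba.2, bb.2, b₁.1, b₃.1]

theorem exists_Mfun_eq_payoffSum {VG : Type} [Finite EG] {G : DirGraph VG EG} {p : List EH}
    {v w : VG} (h : (G.walksFT p.length v w).Nonempty) :
    ∃ q ∈ G.walksFT p.length v w, Mfun G P p v w = (payoffSum P q p : WithTop ℤ) ∧
      ∀ r ∈ G.walksFT p.length v w, payoffSum P q p ≤ payoffSum P r p := by
  obtain ⟨q, hq, hmin⟩ := Set.exists_min_image _ (fun q => payoffSum P q p)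
    (DirGraph.finite_walksFT p.length v w) h
  refine ⟨q, hq, ?_, hmin⟩
  have hleast : IsLeast ((fun q => payoffSum P q p) '' G.walksFT p.length v w)
      (payoffSum P q p) := ⟨⟨q, hq, rfl⟩, by rintro _ ⟨r, hr, rfl⟩; exact hmin r hr⟩
  rw [← hleast.csInf_eq, WithTop.coe_sInf' hleast.nonempty ⟨_, hleast.2⟩, Set.image_image]
  rfl

end Payoff

/-- For a primitive graph `G` there are `N` and `C₀ > 0`, depending only on `G`, such
that for every graph `H`, payoff `P`, `n > N` and `p ∈ W_n(H)`, `M(p)` is `ℤ`-valued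
and `ΔM(p) ≤ C₀ ‖P‖`. -/
theorem Mfun_variation_bounded {VG EG : Type} [Fintype VG] [Fintype EG]
    (G : DirGraph VG EG) (hG : G.Primitive) :
    ∃ (N : ℕ) (C₀ : ℤ), 0 < C₀ ∧
      ∀ (VH EH : Type) [Fintype VH] [Fintype EH] (H : DirGraph VH EH)
        (P : EG → EH → ℤ), ∀ n > N, ∀ p ∈ H.walks n,
        ∃ mz : VG → VG → ℤ,
          (∀ v w : VG, Mfun G P p v w = (mz v w : WithTop ℤ)) ∧
          sSup (Set.range fun vw : VG × VG => mz vw.1 vw.2)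
              - sInf (Set.range fun vw : VG × VG => mz vw.1 vw.2)
            ≤ C₀ * sSup (Set.range fun ee : EG × EH => |P ee.1 ee.2|) := by
  obtain ⟨K, hK⟩ := hG.eventually_nonempty_walksFT
  have := hG.nonempty
  refine ⟨2 * K, 4 * K + 1, by positivity, fun VH EH _ _ H P n hn p hp => ?_⟩
  obtain ⟨rfl, -⟩ := hp
  set B := sSup (Set.range fun ee : EG × EH => |P ee.1 ee.2|)
  have hB : ∀ e f, |P e f| ≤ B := fun e f =>
    le_csSup (Set.finite_range _).bddAbove ⟨(e, f), rfl⟩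
  choose q hq hM hmin using fun v w =>
    exists_Mfun_eq_payoffSum P (hK p.length (by omega) v w)
  refine ⟨fun v w => payoffSum P (q v w) p, hM, ?_⟩
  have hB0 : 0 ≤ B := by
    obtain ⟨v⟩ := this
    obtain ⟨-, -, hq0, -⟩ := hq v v
    have hp0 : p ≠ [] := List.length_pos_iff.1 (by omega)
    exact (abs_nonneg _).trans (hB ((q v v).head hq0) (p.head hp0))
  have hle : ∀ v w v' w', payoffSum P (q v w) p ≤ payoffSum P (q v' w') p + 4 * K * B := by
    intro v w v' w'
    obtain ⟨a, q₁, q₂, q₃, b, hsplit, h₁, h₃, ha, hb, hmem⟩ :=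
      DirGraph.exists_walksFT_replace_ends (hK K le_rfl) hn (hq v' w').1 (hq v' w').2.1 v w
    refine (hmin v w _ hmem).trans ?_
    have hlen := (hq v' w').1.symm
    rw [hsplit] at hlen ⊢
    exact payoffSum_le_of_replace_ends P hB hlen h₁ h₃ ha hb
  have hsup : ∀ v w, sSup (Set.range fun vw : VG × VG => payoffSum P (q vw.1 vw.2) p)
      ≤ payoffSum P (q v w) p + 4 * K * B := fun v w =>
    csSup_le (Set.range_nonempty _) (by rintro _ ⟨vw, rfl⟩; exact hle _ _ _ _)
  have hinf : sSup (Set.range fun vw : VG × VG => payoffSum P (q vw.1 vw.2) p) - 4 * K * B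
      ≤ sInf (Set.range fun vw : VG × VG => payoffSum P (q vw.1 vw.2) p) :=
    le_csInf (Set.range_nonempty _)
      (by rintro _ ⟨vw, rfl⟩; exact sub_le_iff_le_add.2 (hsup _ _))
  linarith
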